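/- Let G be a plane graph and v a node of G with degree d ≥ 4 and neighbors u₁,…,u_d in clockwise order. Let reduce(G, v, u₁) be the plane graph obtained by adding a zero-weight path (v₁,…,v_d), replacing each edge (u_i, v) by an edge (u_i, v_i) of the same weight, and deleting v. Then expand(reduce(G, v, u₁)) = expand(G); in particular girth(reduce(G, v, u₁)) = girth(G). -/

import Mathlib

open SimpleGraph

variable {V : Type*}

/-- The weight of a walk: the sum of the weights of its edges. -/
def walkWeight {G : SimpleGraph V} (w : Sym2 V → ℕ) {u v : V} (p : G.Walk u v) : ℕ :=
  (p.edges.map w).sum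

/-- The girth of a weighted graph: the minimum total weight of a simple cycle
(`⊤` if there is no cycle). -/
noncomputable def wgirth (G : SimpleGraph V) (w : Sym2 V → ℕ) : ℕ∞ :=
  sInf {n : ℕ∞ | ∃ (u : V) (p : G.Walk u u), p.IsCycle ∧ n = (walkWeight w p : ℕ∞)}

/-- Weighted shortest-path distance (`⊤` if there is no walk). -/
noncomputable def wdist (G : SimpleGraph V) (w : Sym2 V → ℕ) (u v : V) : ℕ∞ :=
  sInf {n : ℕ∞ | ∃ p : G.Walk u v, n = (walkWeight w p : ℕ∞)}

section Expand

variable [LinearOrder V]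

/-- Internal vertices of the expanded version of `(G, w)`: for each edge `{a, b}`
with `a < b` of weight `k = w s(a,b)`, the `k - 1` internal vertices of the
replacing path, indexed by `1 ≤ i ≤ k - 1`. -/
abbrev InnerVert (G : SimpleGraph V) (w : Sym2 V → ℕ) : Type _ :=
  {x : V × V × ℕ // x.1 < x.2.1 ∧ G.Adj x.1 x.2.1 ∧ 0 < x.2.2 ∧ x.2.2 < w s(x.1, x.2.1)}

/-- One direction of the adjacency of the (pre-contraction) expanded graph. -/
def preRel (G : SimpleGraph V) (w : Sym2 V → ℕ) :
    (V ⊕ InnerVert G w) → (V ⊕ InnerVert G w) → Prop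
  | .inl u, .inl v => G.Adj u v ∧ w s(u, v) = 1
  | .inl u, .inr x =>
      (u = x.val.1 ∧ x.val.2.2 = 1) ∨ (u = x.val.2.1 ∧ x.val.2.2 + 1 = w s(x.val.1, x.val.2.1))
  | .inr x, .inr y => x.val.1 = y.val.1 ∧ x.val.2.1 = y.val.2.1 ∧ x.val.2.2 + 1 = y.val.2.2
  | _, _ => False

/-- The expanded graph before contracting the zero-weight edges: every edge of
weight `k ≥ 1` is replaced by a path of `k` unit edges. -/
def preExpand (G : SimpleGraph V) (w : Sym2 V → ℕ) : SimpleGraph (V ⊕ InnerVert G w) :=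
  SimpleGraph.fromRel (preRel G w)

/-- Relation generating the identifications coming from zero-weight edges. -/
def zeroRel (G : SimpleGraph V) (w : Sym2 V → ℕ) (x y : V ⊕ InnerVert G w) : Prop :=
  ∃ u v : V, x = .inl u ∧ y = .inl v ∧ G.Adj u v ∧ w s(u, v) = 0

/-- Vertices of the expanded version `expand(G)`: vertices of the subdivision,
with the two endpoints of each zero-weight edge merged. -/
def ExpandVert (G : SimpleGraph V) (w : Sym2 V → ℕ) : Type _ :=
  Quot (zeroRel G w)

/-- The expanded version `expand(G)` of the weighted graph `(G, w)`, as an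
unweighted simple graph. -/
def expandGraph (G : SimpleGraph V) (w : Sym2 V → ℕ) : SimpleGraph (ExpandVert G w) :=
  SimpleGraph.fromRel
    (fun x y => ∃ a b : V ⊕ InnerVert G w,
      x = Quot.mk _ a ∧ y = Quot.mk _ b ∧ (preExpand G w).Adj a b)

end Expand

section Reduce

variable [LinearOrder V]

noncomputable instance {v : V} {d : ℕ} : LinearOrder ({u : V // u ≠ v} ⊕ Fin d) :=
  @linearOrderOfSTO _ WellOrderingRel _ (Classical.decRel _)

/-- One direction of the adjacency of `reduce(G, v, u₁)`, where `e : Fin d → V`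
enumerates the neighbors `u₁, …, u_d` of `v` (in clockwise order, `e 0 = u₁`):
the node `v` is deleted, a path `(v₁, …, v_d)` (the `Fin d` vertices) is added, and
each edge `(u_i, v)` is replaced by the edge `(u_i, v_i)`. -/
def reduceRel (G : SimpleGraph V) (v : V) {d : ℕ} (e : Fin d → V) :
    ({u : V // u ≠ v} ⊕ Fin d) → ({u : V // u ≠ v} ⊕ Fin d) → Prop
  | .inl u, .inl u' => G.Adj ↑u ↑u'
  | .inl u, .inr i => e i = ↑u
  | .inr i, .inr j => (i : ℕ) + 1 = (j : ℕ)
  | _, _ => False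

/-- The plane graph `reduce(G, v, u₁)`. -/
def reduceGraph (G : SimpleGraph V) (v : V) {d : ℕ} (e : Fin d → V) :
    SimpleGraph ({u : V // u ≠ v} ⊕ Fin d) :=
  SimpleGraph.fromRel (reduceRel G v e)

/-- The weights of `reduce(G, v, u₁)`: the path `(v₁, …, v_d)` has zero-weight
edges, and the edge `(u_i, v_i)` inherits the weight `w(u_i, v)`. -/
def reduceF (w : Sym2 V → ℕ) (v : V) {d : ℕ} (e : Fin d → V) :
    ({u : V // u ≠ v} ⊕ Fin d) → ({u : V // u ≠ v} ⊕ Fin d) → ℕ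
  | .inl u, .inl u' => w s(↑u, ↑u')
  | .inl _, .inr i => w s(e i, v)
  | .inr i, .inl _ => w s(e i, v)
  | .inr _, .inr _ => 0

def reduceW (w : Sym2 V → ℕ) (v : V) {d : ℕ} (e : Fin d → V) :
    Sym2 ({u : V // u ≠ v} ⊕ Fin d) → ℕ :=
  Sym2.lift ⟨reduceF w v e, by
    intro x y
    cases x <;> cases y
    · exact congrArg w Sym2.eq_swap
    · rfl
    · rfl
    · rfl⟩

end Reduce

section Points

variable [LinearOrder V]

/-- Representative of the point at distance `i` from `a` on the subdivided edge `ab`. -/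
noncomputable def preEdgePt (G : SimpleGraph V) (w : Sym2 V → ℕ) (a b : V) (i : ℕ) :
    V ⊕ InnerVert G w :=
  open Classical in
  if h : a < b ∧ G.Adj a b ∧ 0 < i ∧ i < w s(a, b) then
    .inr ⟨(a, b, i), h⟩
  else if h : b < a ∧ G.Adj b a ∧ 0 < w s(b, a) - i ∧ w s(b, a) - i < w s(b, a) then
    .inr ⟨(b, a, w s(b, a) - i), h⟩
  else if i = 0 then .inl a else .inl b

/-- The point at distance `i` from `a` on the subdivided edge `ab`. -/
noncomputable def edgePt (G : SimpleGraph V) (w : Sym2 V → ℕ) (a b : V) (i : ℕ) :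
    ExpandVert G w :=
  Quot.mk _ (preEdgePt G w a b i)

theorem preEdgePt_lt {G : SimpleGraph V} {w : Sym2 V → ℕ} {a b : V} {i : ℕ}
    (h : a < b ∧ G.Adj a b ∧ 0 < i ∧ i < w s(a, b)) :
    preEdgePt G w a b i = .inr ⟨(a, b, i), h⟩ := dif_pos h

theorem preEdgePt_gt {G : SimpleGraph V} {w : Sym2 V → ℕ} {a b : V} {i : ℕ}
    (h : b < a ∧ G.Adj b a ∧ 0 < w s(b, a) - i ∧ w s(b, a) - i < w s(b, a)) :
    preEdgePt G w a b i = .inr ⟨(b, a, w s(b, a) - i), h⟩ := by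
  unfold preEdgePt
  rw [dif_neg (fun h' => lt_asymm h.1 h'.1), dif_pos h]

theorem mk_inr_eq_edgePt (G : SimpleGraph V) (w : Sym2 V → ℕ) (x : InnerVert G w) :
    (Quot.mk _ (.inr x) : ExpandVert G w) = edgePt G w x.1.1 x.1.2.1 x.1.2.2 :=
  congrArg (Quot.mk _) (preEdgePt_lt x.2).symm

theorem edgePt_zero (G : SimpleGraph V) (w : Sym2 V → ℕ) (a b : V) :
    edgePt G w a b 0 = Quot.mk _ (.inl a) := by
  refine congrArg (Quot.mk _) ?_
  unfold preEdgePt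
  rw [dif_neg (by simp), dif_neg (by simp), if_pos rfl]

theorem mk_eq_of_zero {G : SimpleGraph V} {w : Sym2 V → ℕ} {a b : V} (h : G.Adj a b)
    (h0 : w s(a, b) = 0) :
    (Quot.mk _ (.inl a) : ExpandVert G w) = Quot.mk _ (.inl b) :=
  Quot.sound ⟨a, b, rfl, rfl, h, h0⟩

theorem edgePt_top {G : SimpleGraph V} {w : Sym2 V → ℕ} {a b : V} (h : G.Adj a b) :
    edgePt G w a b (w s(a, b)) = Quot.mk _ (.inl b) := by
  by_cases h0 : w s(a, b) = 0
  · rw [h0, edgePt_zero]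
    exact mk_eq_of_zero h h0
  · refine congrArg (Quot.mk _) ?_
    have hs : w s(b, a) = w s(a, b) := by rw [Sym2.eq_swap]
    unfold preEdgePt
    rw [dif_neg (by simp), dif_neg (by rw [hs]; simp), if_neg h0]

theorem edgePt_symm {G : SimpleGraph V} {w : Sym2 V → ℕ} {a b : V} (h : G.Adj a b) {i : ℕ}
    (hi : i ≤ w s(a, b)) : edgePt G w a b i = edgePt G w b a (w s(b, a) - i) := by
  have hs : w s(b, a) = w s(a, b) := by rw [Sym2.eq_swap]
  rcases Nat.eq_zero_or_pos i with rfl | h0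
  · rw [edgePt_zero, Nat.sub_zero, edgePt_top h.symm]
  rcases hi.eq_or_lt with rfl | h1
  · rw [edgePt_top h, hs, Nat.sub_self, edgePt_zero]
  rcases lt_or_gt_of_ne h.ne with hab | hab
  · refine congrArg (Quot.mk _) ?_
    rw [preEdgePt_lt ⟨hab, h, h0, h1⟩, preEdgePt_gt ⟨hab, h, by omega, by omega⟩]
    have e1 : w s(a, b) - (w s(b, a) - i) = i := by omega
    simp only [e1]
  · refine congrArg (Quot.mk _) ?_
    rw [preEdgePt_gt ⟨hab, h.symm, by omega, by omega⟩,
      preEdgePt_lt ⟨hab, h.symm, by omega, by omega⟩]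

theorem preRel_edgePt {G : SimpleGraph V} {w : Sym2 V → ℕ} {p q : V ⊕ InnerVert G w}
    (h : preRel G w p q) : ∃ a b i, G.Adj a b ∧ i < w s(a, b) ∧
      (Quot.mk _ p : ExpandVert G w) = edgePt G w a b i ∧
      (Quot.mk _ q : ExpandVert G w) = edgePt G w a b (i + 1) := by
  rcases p with a | ⟨⟨a, b, i⟩, hx⟩ <;> rcases q with c | ⟨⟨c, d, j⟩, hy⟩
  · obtain ⟨h1, h2⟩ := h
    refine ⟨a, c, 0, h1, by omega, (edgePt_zero ..).symm, ?_⟩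
    rw [zero_add, ← h2, edgePt_top h1]
  · rcases h with ⟨h1, h2⟩ | ⟨h1, h2⟩
    · simp only at h1 h2
      subst h1 h2
      refine ⟨a, d, 0, hy.2.1, by have := hy.2.2; simp only at this; omega,
        (edgePt_zero ..).symm, mk_inr_eq_edgePt ..⟩
    · simp only at h1 h2
      subst h1
      have hs : w s(a, c) = w s(c, a) := by rw [Sym2.eq_swap]
      have hy2 : 0 < j ∧ j < w s(c, a) := hy.2.2
      have had : G.Adj c a := hy.2.1
      refine ⟨a, c, 0, had.symm, by omega, (edgePt_zero ..).symm, ?_⟩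
      rw [mk_inr_eq_edgePt, edgePt_symm had hy2.2.le]
      congr 1
      omega
  · exact h.elim
  · obtain ⟨h1, h2, h3⟩ := h
    simp only at h1 h2 h3
    subst h1 h2 h3
    have hx2 : 0 < i ∧ i < w s(a, b) := hx.2.2
    exact ⟨a, b, i, hx.2.1, hx2.2, mk_inr_eq_edgePt .., mk_inr_eq_edgePt ..⟩

theorem expand_adj_of_edgePt {G : SimpleGraph V} {w : Sym2 V → ℕ} {a b : V} {i : ℕ}
    (h : G.Adj a b) (hi : i < w s(a, b))
    (hne : edgePt G w a b i ≠ edgePt G w a b (i + 1)) :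
    (expandGraph G w).Adj (edgePt G w a b i) (edgePt G w a b (i + 1)) := by
  have key : ∀ p q : V ⊕ InnerVert G w, (preRel G w p q ∨ preRel G w q p) →
      (Quot.mk _ p : ExpandVert G w) ≠ Quot.mk _ q →
      (expandGraph G w).Adj (Quot.mk _ p) (Quot.mk _ q) := by
    intro p q h hne
    refine ⟨hne, Or.inl ⟨p, q, rfl, rfl, ?_, h⟩⟩
    rintro rfl
    exact hne rfl
  have main : ∀ (a b : V) (i : ℕ), a < b → G.Adj a b → i < w s(a, b) →
      edgePt G w a b i ≠ edgePt G w a b (i + 1) →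
      (expandGraph G w).Adj (edgePt G w a b i) (edgePt G w a b (i + 1)) := by
    intro a b i hab h hi hne
    rcases Nat.eq_zero_or_pos i with rfl | h0
    · rcases hi.nat_succ_le.eq_or_lt with h1 | h1
      · have e1 := edgePt_top (w := w) h
        have h1' : w s(a, b) = 0 + 1 := h1.symm
        rw [h1'] at e1
        rw [edgePt_zero, e1] at hne ⊢
        exact key _ _ (Or.inl ⟨h, h1'⟩) hne
      · have e1 := mk_inr_eq_edgePt G w ⟨(a, b, 0 + 1), hab, h, by simp, h1⟩
        simp only at e1
        rw [edgePt_zero, ← e1] at hne ⊢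
        exact key _ _ (Or.inl (Or.inl ⟨rfl, rfl⟩)) hne
    · have e0 := mk_inr_eq_edgePt G w ⟨(a, b, i), hab, h, h0, hi⟩
      simp only at e0
      rcases hi.nat_succ_le.eq_or_lt with h1 | h1
      · have e1 := edgePt_top (w := w) h
        have h1' : w s(a, b) = i + 1 := h1.symm
        rw [h1'] at e1
        rw [← e0, e1] at hne ⊢
        exact key _ _ (Or.inr (Or.inr ⟨rfl, h1⟩)) hne
      · have e1 := mk_inr_eq_edgePt G w ⟨(a, b, i + 1), hab, h, by simp, h1⟩
        simp only at e1
        rw [← e0, ← e1] at hne ⊢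
        exact key _ _ (Or.inl ⟨rfl, rfl, rfl⟩) hne
  rcases lt_or_gt_of_ne h.ne with hab | hab
  · exact main a b i hab h hi hne
  · have hs : w s(b, a) = w s(a, b) := by rw [Sym2.eq_swap]
    have e0 := edgePt_symm h hi.le
    have e1 := edgePt_symm h (i := i + 1) hi
    have e2 : w s(b, a) - i = w s(b, a) - (i + 1) + 1 := by omega
    rw [e2] at e0
    rw [e0, e1] at hne ⊢
    exact (main b a _ hab h.symm (by omega) hne.symm).symm

theorem expand_adj_iff {G : SimpleGraph V} {w : Sym2 V → ℕ} {x y : ExpandVert G w} :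
    (expandGraph G w).Adj x y ↔ x ≠ y ∧ ∃ a b i, G.Adj a b ∧ i < w s(a, b) ∧
      x = edgePt G w a b i ∧ y = edgePt G w a b (i + 1) := by
  have rev : ∀ x y : ExpandVert G w, (∃ a b i, G.Adj a b ∧ i < w s(a, b) ∧
      x = edgePt G w a b i ∧ y = edgePt G w a b (i + 1)) → (∃ a b i, G.Adj a b ∧
      i < w s(a, b) ∧ y = edgePt G w a b i ∧ x = edgePt G w a b (i + 1)) := by
    rintro _ _ ⟨a, b, i, h, hi, rfl, rfl⟩
    have hs : w s(b, a) = w s(a, b) := by rw [Sym2.eq_swap]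
    refine ⟨b, a, w s(b, a) - (i + 1), h.symm, by omega, edgePt_symm h hi, ?_⟩
    rw [edgePt_symm h hi.le]
    congr 1
    omega
  constructor
  · rintro ⟨hne, h⟩
    refine ⟨hne, ?_⟩
    rcases h with ⟨p, q, rfl, rfl, -, h | h⟩ | ⟨p, q, rfl, rfl, -, h | h⟩
    · exact preRel_edgePt h
    · exact rev _ _ (preRel_edgePt h)
    · exact rev _ _ (preRel_edgePt h)
    · exact preRel_edgePt h
  · rintro ⟨hne, a, b, i, h, hi, rfl, rfl⟩
    exact expand_adj_of_edgePt h hi hne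

/-- Maps out of the expanded graph. -/
def expandLift {β : Type*} (G : SimpleGraph V) (w : Sym2 V → ℕ) (f : V → β)
    (g : V → V → ℕ → β) (hf : ∀ a b, G.Adj a b → w s(a, b) = 0 → f a = f b) :
    ExpandVert G w → β :=
  Quot.lift (Sum.elim f (fun x => g x.1.1 x.1.2.1 x.1.2.2)) (by
    rintro _ _ ⟨a, b, rfl, rfl, h, h0⟩
    exact hf a b h h0)

theorem expandLift_edgePt {β : Type*} {G : SimpleGraph V} {w : Sym2 V → ℕ} {f : V → β}
    {g : V → V → ℕ → β} {hf : ∀ a b, G.Adj a b → w s(a, b) = 0 → f a = f b}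
    (hsymm : ∀ a b i, G.Adj a b → 0 < w s(a, b) → i ≤ w s(a, b) →
      g a b i = g b a (w s(b, a) - i))
    (hzero : ∀ a b, G.Adj a b → 0 < w s(a, b) → g a b 0 = f a)
    {a b : V} {i : ℕ} (h : G.Adj a b) (hw : 0 < w s(a, b)) (hi : i ≤ w s(a, b)) :
    expandLift G w f g hf (edgePt G w a b i) = g a b i := by
  have hs : w s(b, a) = w s(a, b) := by rw [Sym2.eq_swap]
  rcases Nat.eq_zero_or_pos i with rfl | h0
  · rw [edgePt_zero, hzero a b h hw]
    rfl
  rcases hi.eq_or_lt with rfl | h1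
  · rw [edgePt_top h, hsymm a b _ h hw hi, hs, Nat.sub_self, hzero b a h.symm (by omega)]
    rfl
  rcases lt_or_gt_of_ne h.ne with hab | hab
  · rw [← mk_inr_eq_edgePt G w ⟨(a, b, i), hab, h, h0, h1⟩]
    rfl
  · rw [edgePt_symm h hi, hsymm a b i h hw hi,
      ← mk_inr_eq_edgePt G w ⟨(b, a, w s(b, a) - i), hab, h.symm, by simp only; omega,
        by simp only; omega⟩]
    rfl

end Points

section Girth

theorem walkWeight_cons {G : SimpleGraph V} (w : Sym2 V → ℕ) {a b c : V} (h : G.Adj a b)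
    (p : G.Walk b c) : walkWeight w (Walk.cons h p) = w s(a, b) + walkWeight w p := by
  simp [walkWeight]

theorem wgirth_le_of_walk {G : SimpleGraph V} (w : Sym2 V → ℕ) {a b : V} (h : G.Adj a b)
    (p : G.Walk b a) (hp : s(a, b) ∉ p.edges) :
    wgirth G w ≤ ((w s(a, b) + walkWeight w p : ℕ) : ℕ∞) := by
  classical
  have h1 : walkWeight w p.bypass ≤ walkWeight w p := by
    have hsub := (List.subperm_of_subset p.bypass_isPath.isTrail.edges_nodup
      p.edges_bypass_subset_edges)
    obtain ⟨l, hl, hl2⟩ := hsub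
    unfold walkWeight
    rw [← (hl.map w).sum_eq]
    exact (hl2.map w).sum_le_sum (by simp)
  have hc : (Walk.cons h p.bypass).IsCycle :=
    (Walk.cons_isCycle_iff _ h).2 ⟨p.bypass_isPath, fun hh => hp (p.edges_bypass_subset_edges hh)⟩
  refine le_trans (sInf_le ⟨a, _, hc, rfl⟩) ?_
  rw [walkWeight_cons]
  exact_mod_cast Nat.add_le_add_left h1 _

end Girth

section ReduceLemmas

variable {G : SimpleGraph V} {w : Sym2 V → ℕ} {v : V} {d : ℕ} {e : Fin d → V}

/-- Projection of the reduced vertex set. -/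
def redProj (v : V) (d : ℕ) : ({u : V // u ≠ v} ⊕ Fin d) → V
  | .inl u => u
  | .inr _ => v

theorem reduce_adj_cases (hnbr : ∀ u : V, G.Adj v u ↔ ∃ i, e i = u)
    {x y : {u : V // u ≠ v} ⊕ Fin d} (h : (reduceGraph G v e).Adj x y) :
    (G.Adj (redProj v d x) (redProj v d y) ∧
      reduceW w v e s(x, y) = w s(redProj v d x, redProj v d y)) ∨
    (∃ i j, x = .inr i ∧ y = .inr j ∧ ((i : ℕ) + 1 = j ∨ (j : ℕ) + 1 = i) ∧
      reduceW w v e s(x, y) = 0) := by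
  obtain ⟨hne, h⟩ := h
  rcases x with x | i <;> rcases y with y | j
  · left
    exact ⟨h.elim id (fun h => G.adj_symm h), rfl⟩
  · left
    have h' : e j = x := h.elim id False.elim
    refine ⟨((hnbr _).2 ⟨j, h'⟩).symm, ?_⟩
    change w s(e j, v) = w s(↑x, v)
    rw [h']
  · left
    have h' : e i = y := h.elim False.elim id
    refine ⟨(hnbr _).2 ⟨i, h'⟩, ?_⟩
    change w s(e i, v) = w s(v, ↑y)
    rw [h', Sym2.eq_swap]
  · right
    exact ⟨i, j, rfl, rfl, h, rfl⟩

theorem reduce_edge_inj (hinj : Function.Injective e)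
    {x y x' y' : {u : V // u ≠ v} ⊕ Fin d}
    (h : (reduceGraph G v e).Adj x y) (h' : (reduceGraph G v e).Adj x' y')
    (hne : redProj v d x ≠ redProj v d y)
    (hx : redProj v d x = redProj v d x') (hy : redProj v d y = redProj v d y') :
    x = x' ∧ y = y' := by
  obtain ⟨-, h⟩ := h
  obtain ⟨-, h'⟩ := h'
  rcases x with ⟨x, hxv⟩ | i <;> rcases y with ⟨y, hyv⟩ | j <;>
    rcases x' with ⟨x', hxv'⟩ | i' <;> rcases y' with ⟨y', hyv'⟩ | j' <;>
    simp only [redProj, reduceRel, or_false, false_or] at * <;>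
    first
    | (exfalso; exact hne rfl)
    | (exfalso; exact hxv hx)
    | (exfalso; exact hyv hy)
    | (exfalso; exact hxv' hx.symm)
    | (exfalso; exact hyv' hy.symm)
    | skip
  · subst hx hy
    simp
  · subst hx
    have : j = j' := hinj (h.trans h'.symm)
    subst this
    simp
  · subst hy
    have : i = i' := hinj (h.trans h'.symm)
    subst this
    simp

open Classical in
/-- The endpoint at `a` of the lift to the reduced graph of the edge `ab`. -/
noncomputable def redLift (v : V) {d : ℕ} (e : Fin d → V) (i₀ : Fin d) (a b : V) :
    {u : V // u ≠ v} ⊕ Fin d :=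
  if h : a = v then (if h' : ∃ i, e i = b then .inr h'.choose else .inr i₀) else .inl ⟨a, h⟩

theorem redProj_redLift (i₀ : Fin d) (a b : V) : redProj v d (redLift v e i₀ a b) = a := by
  unfold redLift
  split_ifs with h h'
  · exact h.symm
  · exact h.symm
  · rfl

theorem redLift_adj (hnbr : ∀ u : V, G.Adj v u ↔ ∃ i, e i = u) (i₀ : Fin d) {a b : V}
    (h : G.Adj a b) :
    (reduceGraph G v e).Adj (redLift v e i₀ a b) (redLift v e i₀ b a) := by
  refine ⟨fun hh => h.ne ?_, ?_⟩
  · have := congrArg (redProj v d) hh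
    rwa [redProj_redLift, redProj_redLift] at this
  by_cases ha : a = v
  · subst ha
    have hb : ¬ b = a := h.ne'
    have h' := (hnbr b).1 h
    right
    unfold redLift
    rw [dif_pos rfl, dif_pos h', dif_neg hb]
    exact h'.choose_spec
  · by_cases hb : b = v
    · subst hb
      have h' := (hnbr a).1 h.symm
      left
      unfold redLift
      rw [dif_neg ha, dif_pos rfl, dif_pos h']
      exact h'.choose_spec
    · left
      unfold redLift
      rw [dif_neg ha, dif_neg hb]
      exact h

theorem redLift_weight (hnbr : ∀ u : V, G.Adj v u ↔ ∃ i, e i = u) (i₀ : Fin d) {a b : V}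
    (h : G.Adj a b) :
    reduceW w v e s(redLift v e i₀ a b, redLift v e i₀ b a) = w s(a, b) := by
  rcases reduce_adj_cases (w := w) hnbr (redLift_adj hnbr i₀ h) with ⟨-, h2⟩ | ⟨i, j, h1, h2, -⟩
  · rw [h2, redProj_redLift, redProj_redLift]
  · exfalso
    have e1 := redProj_redLift (v := v) (e := e) i₀ a b
    have e2 := redProj_redLift (v := v) (e := e) i₀ b a
    rw [h1] at e1
    rw [h2] at e2
    exact h.ne (e1.symm.trans e2)

theorem redLift_redProj (hinj : Function.Injective e)
    (hnbr : ∀ u : V, G.Adj v u ↔ ∃ i, e i = u) (i₀ : Fin d)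
    {x y : {u : V // u ≠ v} ⊕ Fin d} (h : (reduceGraph G v e).Adj x y)
    (hG : G.Adj (redProj v d x) (redProj v d y)) :
    redLift v e i₀ (redProj v d x) (redProj v d y) = x ∧
    redLift v e i₀ (redProj v d y) (redProj v d x) = y := by
  have := reduce_edge_inj hinj h (redLift_adj hnbr i₀ hG) hG.ne
    (redProj_redLift ..).symm (redProj_redLift ..).symm
  exact ⟨this.1.symm, this.2.symm⟩

theorem path_adj {i j : Fin d} (h : (i : ℕ) + 1 = j) :
    (reduceGraph G v e).Adj (.inr i) (.inr j) := by
  refine ⟨?_, Or.inl h⟩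
  intro hh
  have := Sum.inr.inj hh
  subst this
  omega

theorem exists_path_walk (i : Fin d) : ∀ (n : ℕ) (j : Fin d), (i : ℕ) + n = j →
    ∃ p : (reduceGraph G v e).Walk (.inr i) (.inr j), walkWeight (reduceW w v e) p = 0 ∧
      ∀ f ∈ p.edges, (f.map (redProj v d)).IsDiag
  | 0, j, h => by
    have : i = j := Fin.ext (by omega)
    subst this
    exact ⟨Walk.nil, rfl, by simp⟩
  | n + 1, j, h => by
    have hj := j.2
    obtain ⟨p, hp, hp'⟩ := exists_path_walk i n ⟨(i : ℕ) + n, by omega⟩ rfl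
    have hadj : (reduceGraph G v e).Adj (.inr ⟨(i : ℕ) + n, by omega⟩) (.inr j) :=
      path_adj (by simp only; omega)
    refine ⟨p.concat hadj, ?_, ?_⟩
    · unfold walkWeight at hp ⊢
      rw [Walk.edges_concat]
      simp only [List.concat_eq_append, List.map_append, List.sum_append, hp]
      rfl
    · intro f hf
      rw [Walk.edges_concat, List.concat_eq_append, List.mem_append] at hf
      rcases hf with hf | hf
      · exact hp' f hf
      · rw [List.mem_singleton] at hf
        subst hf
        rfl

theorem exists_fiber_walk (x y : {u : V // u ≠ v} ⊕ Fin d)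
    (h : redProj v d x = redProj v d y) :
    ∃ p : (reduceGraph G v e).Walk x y, walkWeight (reduceW w v e) p = 0 ∧
      ∀ f ∈ p.edges, (f.map (redProj v d)).IsDiag := by
  rcases x with ⟨x, hx⟩ | i <;> rcases y with ⟨y, hy⟩ | j
  · change x = y at h
    subst h
    exact ⟨Walk.nil, rfl, by simp⟩
  · exact absurd h hx
  · exact absurd h.symm hy
  · rcases le_total (i : ℕ) j with hij | hij
    · exact exists_path_walk i (j - i) j (by omega)
    · obtain ⟨p, h1, h2⟩ := exists_path_walk (G := G) (w := w) (v := v) (e := e)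
        j (i - j) i (by omega)
      refine ⟨p.reverse, ?_, ?_⟩
      · unfold walkWeight at h1 ⊢
        rw [Walk.edges_reverse, List.map_reverse, List.sum_reverse, h1]
      · intro f hf
        rw [Walk.edges_reverse, List.mem_reverse] at hf
        exact h2 f hf

theorem walkWeight_append {G : SimpleGraph V} (w : Sym2 V → ℕ) {a b c : V} (p : G.Walk a b)
    (q : G.Walk b c) : walkWeight w (p.append q) = walkWeight w p + walkWeight w q := by
  simp [walkWeight, Walk.edges_append]

theorem exists_lift_walk (hnbr : ∀ u : V, G.Adj v u ↔ ∃ i, e i = u) (i₀ : Fin d) {a b : V}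
    (p : G.Walk a b) : ∀ (x y : {u : V // u ≠ v} ⊕ Fin d), redProj v d x = a →
      redProj v d y = b → ∃ q : (reduceGraph G v e).Walk x y,
      walkWeight (reduceW w v e) q = walkWeight w p ∧
      ∀ f ∈ q.edges, (f.map (redProj v d)).IsDiag ∨ f.map (redProj v d) ∈ p.edges := by
  induction p with
  | nil =>
    intro x y hx hy
    obtain ⟨q, h1, h2⟩ := exists_fiber_walk (G := G) (w := w) (e := e) x y (hx.trans hy.symm)
    exact ⟨q, h1, fun f hf => Or.inl (h2 f hf)⟩
  | @cons a b c h p ih =>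
    intro x y hx hy
    obtain ⟨q₁, h1, h2⟩ := exists_fiber_walk (G := G) (w := w) (e := e) x
      (redLift v e i₀ a b) (by rw [redProj_redLift, hx])
    obtain ⟨q₂, h3, h4⟩ := ih (redLift v e i₀ b a) y (redProj_redLift ..) hy
    refine ⟨q₁.append (Walk.cons (redLift_adj hnbr i₀ h) q₂), ?_, ?_⟩
    · rw [walkWeight_append, walkWeight_cons, walkWeight_cons, h1, h3, redLift_weight hnbr i₀ h,
        zero_add]
    · intro f hf
      rw [Walk.edges_append, List.mem_append, Walk.edges_cons, List.mem_cons] at hf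
      rw [Walk.edges_cons, List.mem_cons]
      rcases hf with hf | rfl | hf
      · exact Or.inl (h2 f hf)
      · right; left
        rw [Sym2.map_mk, redProj_redLift, redProj_redLift]
      · exact (h4 f hf).imp id Or.inr

theorem exists_proj_walk (hnbr : ∀ u : V, G.Adj v u ↔ ∃ i, e i = u)
    {x y : {u : V // u ≠ v} ⊕ Fin d} (p : (reduceGraph G v e).Walk x y) :
    ∃ q : G.Walk (redProj v d x) (redProj v d y),
      walkWeight w q = walkWeight (reduceW w v e) p ∧
      ∀ f ∈ q.edges, ∃ f' ∈ p.edges, f'.map (redProj v d) = f := by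
  induction p with
  | nil => exact ⟨Walk.nil, rfl, by simp⟩
  | @cons x y z h p ih =>
    obtain ⟨q, h1, h2⟩ := ih
    rcases reduce_adj_cases (w := w) hnbr h with ⟨h3, h4⟩ | ⟨i, j, rfl, rfl, -, h4⟩
    · refine ⟨Walk.cons h3 q, by rw [walkWeight_cons, walkWeight_cons, h1, h4], ?_⟩
      intro f hf
      rw [Walk.edges_cons, List.mem_cons] at hf
      rcases hf with rfl | hf
      · exact ⟨s(x, y), by simp, rfl⟩
      · obtain ⟨f', h5, h6⟩ := h2 f hf
        exact ⟨f', by simp [h5], h6⟩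
    · refine ⟨q, by rw [walkWeight_cons, h4, zero_add]; exact h1, ?_⟩
      intro f hf
      obtain ⟨k, h5, h6⟩ := h2 f hf
      exact ⟨k, by simp [h5], h6⟩

/-- Position of a reduced vertex on the added path. -/
def redPos (v : V) (d : ℕ) : ({u : V // u ≠ v} ⊕ Fin d) → ℕ
  | .inl _ => 0
  | .inr i => i

theorem side_of_walk {x y : {u : V // u ≠ v} ⊕ Fin d} (p : (reduceGraph G v e).Walk x y)
    (hs : ∀ z ∈ p.support, ∃ i, z = .inr i) (i j : Fin d) (hij : (i : ℕ) + 1 = j)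
    (he : s(Sum.inr i, Sum.inr j) ∉ p.edges) :
    redPos v d x ≤ i ↔ redPos v d y ≤ i := by
  induction p with
  | nil => exact Iff.rfl
  | @cons x y z h p ih =>
    rw [Walk.edges_cons, List.mem_cons, not_or] at he
    rw [← ih (fun z hz => hs z (by simp [hz])) he.2]
    obtain ⟨k, rfl⟩ := hs x (by simp)
    obtain ⟨l, rfl⟩ := hs y (by simp)
    have h' : (k : ℕ) + 1 = l ∨ (l : ℕ) + 1 = k := h.2
    change (k : ℕ) ≤ i ↔ (l : ℕ) ≤ i
    by_contra hcon
    apply he.1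
    rcases h' with h' | h'
    · have e1 : i = k := Fin.ext (by omega)
      have e2 : j = l := Fin.ext (by omega)
      rw [e1, e2]
    · have e1 : i = l := Fin.ext (by omega)
      have e2 : j = k := Fin.ext (by omega)
      rw [e1, e2, Sym2.eq_swap]

theorem exists_inl_of_cycle {x : {u : V // u ≠ v} ⊕ Fin d} (p : (reduceGraph G v e).Walk x x)
    (hp : p.IsCycle) : ∃ u, Sum.inl u ∈ p.support := by
  by_contra hcon
  push Not at hcon
  have hs : ∀ z ∈ p.support, ∃ i, z = Sum.inr i := by
    rintro (u | i) hz
    · exact absurd hz (hcon u)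
    · exact ⟨i, rfl⟩
  cases p with
  | nil => exact hp.not_nil Walk.Nil.nil
  | @cons _ y _ h p =>
    obtain ⟨i, rfl⟩ := hs x (by simp)
    obtain ⟨j, rfl⟩ := hs y (by simp)
    rw [Walk.cons_isCycle_iff] at hp
    have hs' : ∀ z ∈ p.support, ∃ i, z = Sum.inr i := fun z hz => hs z (by simp [hz])
    have h' : (i : ℕ) + 1 = j ∨ (j : ℕ) + 1 = i := h.2
    rcases h' with h' | h'
    · have := side_of_walk p hs' i j h' hp.2
      change (j : ℕ) ≤ i ↔ (i : ℕ) ≤ i at this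
      omega
    · have := side_of_walk p hs' j i h' (by rw [Sym2.eq_swap]; exact hp.2)
      change (j : ℕ) ≤ j ↔ (i : ℕ) ≤ j at this
      omega

theorem wgirth_reduce (hinj : Function.Injective e)
    (hnbr : ∀ u : V, G.Adj v u ↔ ∃ i, e i = u) (i₀ : Fin d) :
    wgirth (reduceGraph G v e) (reduceW w v e) = wgirth G w := by
  classical
  apply le_antisymm
  · refine le_sInf ?_
    rintro _ ⟨a, p, hp, rfl⟩
    cases p with
    | nil => exact absurd Walk.Nil.nil hp.not_nil
    | @cons _ b _ h p =>
      rw [Walk.cons_isCycle_iff] at hp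
      obtain ⟨q, h1, h2⟩ := exists_lift_walk (w := w) hnbr i₀ p (redLift v e i₀ b a)
        (redLift v e i₀ a b) (redProj_redLift ..) (redProj_redLift ..)
      rw [walkWeight_cons, ← h1, ← redLift_weight (w := w) hnbr i₀ h]
      apply wgirth_le_of_walk _ (redLift_adj hnbr i₀ h)
      intro hmem
      rcases h2 _ hmem with h3 | h3
      · rw [Sym2.map_mk, redProj_redLift, redProj_redLift] at h3
        exact h.ne h3
      · rw [Sym2.map_mk, redProj_redLift, redProj_redLift] at h3
        exact hp.2 h3
  · refine le_sInf ?_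
    rintro _ ⟨x, p, hp, rfl⟩
    obtain ⟨u, hu⟩ := exists_inl_of_cycle p hp
    have hw : walkWeight (reduceW w v e) p = walkWeight (reduceW w v e) (p.rotate _ hu) := by
      unfold walkWeight
      exact ((p.rotate_edges _ hu).perm.map _).sum_eq.symm
    rw [hw]
    have hp' := hp.rotate hu
    generalize p.rotate _ hu = q at hp'
    cases q with
    | nil => exact absurd Walk.Nil.nil hp'.not_nil
    | @cons _ y _ h q =>
      rw [Walk.cons_isCycle_iff] at hp'
      rcases reduce_adj_cases (w := w) hnbr h with ⟨h3, h4⟩ | ⟨i, j, h5, -⟩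
      · obtain ⟨r, h1, h2⟩ := exists_proj_walk (w := w) hnbr q
        rw [walkWeight_cons, ← h1, h4]
        apply wgirth_le_of_walk _ h3
        intro hmem
        obtain ⟨f, hf, hf2⟩ := h2 _ hmem
        apply hp'.2
        have hadj := q.edges_subset_edgeSet hf
        induction f using Sym2.ind with
        | _ a b =>
          rw [SimpleGraph.mem_edgeSet] at hadj
          rw [Sym2.map_mk, Sym2.eq_iff] at hf2
          rcases hf2 with ⟨e1, e2⟩ | ⟨e1, e2⟩
          · obtain ⟨rfl, rfl⟩ := reduce_edge_inj hinj h hadj h3.ne e1.symm e2.symm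
            exact hf
          · obtain ⟨e3, e4⟩ := reduce_edge_inj hinj h hadj.symm h3.ne e2.symm e1.symm
            rw [← e3, ← e4, Sym2.eq_swap] at hf
            exact hf
      · exact absurd h5 (by simp)

end ReduceLemmas

section ExpandIso

variable [LinearOrder V] {G : SimpleGraph V} {w : Sym2 V → ℕ} {v : V} {d : ℕ} {e : Fin d → V}

theorem fiber_mk_eq (x y : {u : V // u ≠ v} ⊕ Fin d)
    (h : redProj v d x = redProj v d y) :
    (Quot.mk _ (.inl x) : ExpandVert (reduceGraph G v e) (reduceW w v e)) =
      Quot.mk _ (.inl y) := by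
  obtain ⟨p, h1, -⟩ := exists_fiber_walk (G := G) (w := w) (e := e) x y h
  clear h
  induction p with
  | nil => rfl
  | cons h p ih =>
    rw [walkWeight_cons] at h1
    exact (mk_eq_of_zero h (by omega)).trans (ih (by omega))

theorem expand_reduce_iso (hinj : Function.Injective e)
    (hnbr : ∀ u : V, G.Adj v u ↔ ∃ i, e i = u) (i₀ : Fin d) :
    Nonempty (expandGraph (reduceGraph G v e) (reduceW w v e) ≃g expandGraph G w) := by
  have hfF : ∀ a b, (reduceGraph G v e).Adj a b → reduceW w v e s(a, b) = 0 →
      (Quot.mk _ (.inl (redProj v d a)) : ExpandVert G w) =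
        Quot.mk _ (.inl (redProj v d b)) := by
    intro a b h h0
    rcases reduce_adj_cases (w := w) hnbr h with ⟨h1, h2⟩ | ⟨i, j, rfl, rfl, -⟩
    · exact mk_eq_of_zero h1 (h2.symm.trans h0)
    · rfl
  have hfH : ∀ a b, G.Adj a b → w s(a, b) = 0 →
      (Quot.mk _ (.inl (redLift v e i₀ a a)) :
        ExpandVert (reduceGraph G v e) (reduceW w v e)) =
        Quot.mk _ (.inl (redLift v e i₀ b b)) := by
    intro a b h h0
    refine (fiber_mk_eq _ (redLift v e i₀ a b) ?_).trans
      ((mk_eq_of_zero (redLift_adj hnbr i₀ h) ?_).trans (fiber_mk_eq _ _ ?_))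
    · rw [redProj_redLift, redProj_redLift]
    · rw [redLift_weight hnbr i₀ h, h0]
    · rw [redProj_redLift, redProj_redLift]
  have hpos : ∀ a b, (reduceGraph G v e).Adj a b → 0 < reduceW w v e s(a, b) →
      G.Adj (redProj v d a) (redProj v d b) ∧
        reduceW w v e s(a, b) = w s(redProj v d a, redProj v d b) := by
    intro a b h h0
    rcases reduce_adj_cases (w := w) hnbr h with h1 | ⟨i, j, -, -, -, h1⟩
    · exact h1
    · omega
  let F : ExpandVert (reduceGraph G v e) (reduceW w v e) → ExpandVert G w :=
    expandLift (β := ExpandVert G w) (reduceGraph G v e) (reduceW w v e)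
    (fun x => (Quot.mk _ (.inl (redProj v d x)) : ExpandVert G w))
    (fun x y i => edgePt G w (redProj v d x) (redProj v d y) i) hfF
  let H : ExpandVert G w → ExpandVert (reduceGraph G v e) (reduceW w v e) :=
    expandLift (β := ExpandVert (reduceGraph G v e) (reduceW w v e)) G w
    (fun a => (Quot.mk _ (.inl (redLift v e i₀ a a)) :
        ExpandVert (reduceGraph G v e) (reduceW w v e)))
    (fun a b i => edgePt (reduceGraph G v e) (reduceW w v e) (redLift v e i₀ a b)
      (redLift v e i₀ b a) i) hfH
  have hF : ∀ a b i, (reduceGraph G v e).Adj a b → 0 < reduceW w v e s(a, b) →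
      i ≤ reduceW w v e s(a, b) →
      F (edgePt (reduceGraph G v e) (reduceW w v e) a b i) =
        edgePt G w (redProj v d a) (redProj v d b) i := by
    intro a b i h hw hi
    refine expandLift_edgePt (hf := hfF) ?_ ?_ h hw hi
    · intro a b i h hw hi
      obtain ⟨h1, h2⟩ := hpos a b h hw
      have h3 : reduceW w v e s(b, a) = w s(redProj v d b, redProj v d a) := by
        rw [Sym2.eq_swap, h2, Sym2.eq_swap]
      rw [h3]
      exact edgePt_symm h1 (h2 ▸ hi)
    · intro a b h hw
      exact edgePt_zero ..
  have hH : ∀ a b i, G.Adj a b → 0 < w s(a, b) → i ≤ w s(a, b) →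
      H (edgePt G w a b i) = edgePt (reduceGraph G v e) (reduceW w v e)
        (redLift v e i₀ a b) (redLift v e i₀ b a) i := by
    intro a b i h hw hi
    refine expandLift_edgePt (hf := hfH) ?_ ?_ h hw hi
    · intro a b i h hw hi
      rw [← redLift_weight (w := w) hnbr i₀ h.symm]
      exact edgePt_symm (redLift_adj hnbr i₀ h) (by rw [redLift_weight hnbr i₀ h]; exact hi)
    · intro a b h hw
      rw [edgePt_zero]
      apply fiber_mk_eq
      rw [redProj_redLift, redProj_redLift]
  have hHF : ∀ x, H (F x) = x := by
    rintro ⟨x | x⟩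
    · change (Quot.mk _ (.inl (redLift v e i₀ (redProj v d x) (redProj v d x))) :
        ExpandVert (reduceGraph G v e) (reduceW w v e)) = Quot.mk _ (.inl x)
      apply fiber_mk_eq
      rw [redProj_redLift]
    · change H (F (Quot.mk _ (.inr x))) = Quot.mk _ (.inr x)
      rw [mk_inr_eq_edgePt]
      obtain ⟨⟨a, b, i⟩, h1, h2, h3, h4⟩ := x
      simp only at h1 h2 h3 h4 ⊢
      obtain ⟨h5, h6⟩ := hpos a b h2 (by omega)
      rw [hF a b i h2 (by omega) h4.le, hH _ _ _ h5 (by omega) (by omega),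
        (redLift_redProj hinj hnbr i₀ h2 h5).1, (redLift_redProj hinj hnbr i₀ h2 h5).2]
  have hFH : ∀ x, F (H x) = x := by
    rintro ⟨x | x⟩
    · change (Quot.mk _ (.inl (redProj v d (redLift v e i₀ x x))) : ExpandVert G w) =
        Quot.mk _ (.inl x)
      rw [redProj_redLift]
    · change F (H (Quot.mk _ (.inr x))) = Quot.mk _ (.inr x)
      rw [mk_inr_eq_edgePt]
      obtain ⟨⟨a, b, i⟩, h1, h2, h3, h4⟩ := x
      simp only at h1 h2 h3 h4 ⊢
      have h6 := redLift_weight (w := w) hnbr i₀ h2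
      rw [hH a b i h2 (by omega) h4.le, hF _ _ _ (redLift_adj hnbr i₀ h2) (by omega) (by omega),
        redProj_redLift, redProj_redLift]
  have adjF : ∀ x y, (expandGraph (reduceGraph G v e) (reduceW w v e)).Adj x y →
      (expandGraph G w).Adj (F x) (F y) := by
    intro x y hxy
    rw [expand_adj_iff] at hxy ⊢
    obtain ⟨hne, a, b, i, h, hi, rfl, rfl⟩ := hxy
    refine ⟨fun hh => hne ?_, ?_⟩
    · have := congrArg H hh
      rwa [hHF, hHF] at this
    · obtain ⟨h5, h6⟩ := hpos a b h (by omega)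
      exact ⟨_, _, i, h5, by omega, hF a b i h (by omega) hi.le, hF a b (i + 1) h (by omega) hi⟩
  have adjH : ∀ x y, (expandGraph G w).Adj x y →
      (expandGraph (reduceGraph G v e) (reduceW w v e)).Adj (H x) (H y) := by
    intro x y hxy
    rw [expand_adj_iff] at hxy ⊢
    obtain ⟨hne, a, b, i, h, hi, rfl, rfl⟩ := hxy
    refine ⟨fun hh => hne ?_, ?_⟩
    · have := congrArg F hh
      rwa [hFH, hFH] at this
    · have h6 := redLift_weight (w := w) hnbr i₀ h
      exact ⟨_, _, i, redLift_adj hnbr i₀ h, by omega, hH a b i h (by omega) hi.le,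
        hH a b (i + 1) h (by omega) hi⟩
  refine ⟨⟨⟨F, H, hHF, hFH⟩, ?_⟩⟩
  intro x y
  constructor
  · intro h
    have : (expandGraph (reduceGraph G v e) (reduceW w v e)).Adj (H (F x)) (H (F y)) :=
      adjH _ _ h
    rwa [hHF, hHF] at this
  · exact adjF x y

end ExpandIso

/-- Let `v` be a node of degree `d ≥ 4` of a plane graph `G`, with
neighbors `u₁, …, u_d` in clockwise order (enumerated by `e : Fin d → V`).  Then
`expand(reduce(G, v, u₁)) = expand(G)` (as an isomorphism of graphs); in particular
`girth(reduce(G, v, u₁)) = girth(G)`. -/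
theorem expand_reduce_eq {V : Type*} [Fintype V] [LinearOrder V]
    (G : SimpleGraph V) (w : Sym2 V → ℕ) (v : V) (d : ℕ) (hd : 4 ≤ d)
    (e : Fin d → V) (hinj : Function.Injective e)
    (hnbr : ∀ u : V, G.Adj v u ↔ ∃ i, e i = u) :
    Nonempty (expandGraph (reduceGraph G v e) (reduceW w v e) ≃g expandGraph G w) ∧
      wgirth (reduceGraph G v e) (reduceW w v e) = wgirth G w := by
  have i₀ : Fin d := ⟨0, by omega⟩
  exact ⟨expand_reduce_iso hinj hnbr i₀, wgirth_reduce hinj hnbr i₀⟩
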